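/- arXiv:2402.04752 — 3 statements merged into one kernel-verified Lean document; each statement's English description precedes it below -/
import Mathlib

section
/- For every dimension d ≥ 1 and every α ∈ (0,2) there exist constants C_{d,α} > 0 and c_{d,α} > 0, depending only on d and α, such that for every real symmetric positive semidefinite d×d matrix a and every ξ ∈ ℝ^d with ξ ≠ 0, q(ξ; a) = C_{d,α}·Tr(a)·‖ξ‖^α + c_{d,α}·⟨a ξ̂, ξ̂⟩·‖ξ‖^α, where ξ̂ := ξ/‖ξ‖ and Tr(a) is the trace of a. -/
open MeasureTheory
open scoped RealInnerProductSpace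

/-- The stable-like symbol `q(ξ; a) = ∫_{ℝ^d} (1 − cos⟨z, ξ⟩)·⟨a z, z⟩/‖z‖^(d+α+2) dz`. -/
noncomputable def stableSymbol (d : ℕ) (α : ℝ) (a : Matrix (Fin d) (Fin d) ℝ)
    (ξ : EuclideanSpace ℝ (Fin d)) : ℝ :=
  ∫ z : EuclideanSpace ℝ (Fin d),
    (1 - Real.cos ⟪z, ξ⟫) * (∑ i, a.mulVec z i * z i) / ‖z‖ ^ ((d : ℝ) + α + 2)

/-- generic weighted integrand -/
noncomputable def gI (d : ℕ) (α : ℝ) (φ : ℝ → ℝ) (ξ v z : EuclideanSpace ℝ (Fin d)) : ℝ :=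
  φ ⟪z, ξ⟫ * ⟪z, v⟫ ^ 2 / ‖z‖ ^ ((d : ℝ) + α + 2)

/-- generic weighted integral -/
noncomputable def gK (d : ℕ) (α : ℝ) (φ : ℝ → ℝ) (ξ v : EuclideanSpace ℝ (Fin d)) : ℝ :=
  ∫ z, gI d α φ ξ v z

/-- admissible weights -/
def Adm (φ : ℝ → ℝ) : Prop :=
  Continuous φ ∧ (∀ s, φ (-s) = φ s) ∧ (∀ s, |φ s| ≤ 2 * min 1 (s ^ 2))

lemma adm_cos : Adm (fun s => 1 - Real.cos s) := by
  refine ⟨by fun_prop, by simp, fun s => ?_⟩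
  have h1 := Real.cos_le_one s
  have h2 := Real.neg_one_le_cos s
  have h3 := Real.one_sub_sq_div_two_le_cos (x := s)
  rw [abs_of_nonneg (by linarith)]
  rcases min_cases 1 (s ^ 2) with ⟨h, _⟩ | ⟨h, _⟩ <;> rw [h]
  · linarith
  · nlinarith [sq_nonneg s]

lemma adm_exp : Adm (fun s => 1 - Real.exp (-(s ^ 2 / 2))) := by
  refine ⟨by fun_prop, by simp, fun s => ?_⟩
  have h1 : Real.exp (-(s ^ 2 / 2)) ≤ 1 := Real.exp_le_one_iff.2 (by nlinarith [sq_nonneg s])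
  have h2 := Real.exp_pos (-(s ^ 2 / 2))
  have h3 := Real.add_one_le_exp (-(s ^ 2 / 2))
  rw [abs_of_nonneg (by linarith)]
  rcases min_cases 1 (s ^ 2) with ⟨h, _⟩ | ⟨h, _⟩ <;> rw [h]
  · linarith
  · nlinarith [sq_nonneg s]

/-- radial majorant -/
noncomputable def hB (d : ℕ) (α : ℝ) (y : ℝ) : ℝ := min 1 (y ^ 2) * y ^ 2 / y ^ ((d : ℝ) + α + 2)

lemma hB_integrable (d : ℕ) (hd : 1 ≤ d) (α : ℝ) (hα0 : 0 < α) (hα2 : α < 2) :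
    Integrable (fun z : EuclideanSpace ℝ (Fin d) => hB d α ‖z‖) := by
  have : Nonempty (Fin d) := ⟨⟨0, hd⟩⟩
  have : Nontrivial (EuclideanSpace ℝ (Fin d)) := by infer_instance
  rw [integrable_fun_norm_addHaar (volume : Measure (EuclideanSpace ℝ (Fin d))) (f := hB d α)]
  have key : ∀ y : ℝ, 0 < y → y ^ (Module.finrank ℝ (EuclideanSpace ℝ (Fin d)) - 1) • hB d α y
      = min 1 (y ^ 2) * y ^ (-1 - α) := by
    intro y hy
    rw [finrank_euclideanSpace_fin, hB, smul_eq_mul]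
    have e1 : y ^ (d - 1) = y ^ ((d : ℝ) - 1) := by
      rw [← Real.rpow_natCast, Nat.cast_sub hd]; simp
    have e2 : y ^ ((d : ℝ) - 1) * y ^ 2 = y ^ (-1 - α) * y ^ ((d : ℝ) + α + 2) := by
      rw [← Real.rpow_natCast y 2, ← Real.rpow_add hy, ← Real.rpow_add hy]
      congr 1; push_cast; ring
    have e3 : y ^ ((d : ℝ) + α + 2) ≠ 0 := (Real.rpow_pos_of_pos hy _).ne'
    rw [e1, mul_div_assoc', div_eq_iff e3]
    linear_combination min 1 (y ^ 2) * e2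
  rw [← Set.Ioc_union_Ioi_eq_Ioi (zero_le_one (α := ℝ))]
  refine IntegrableOn.union ?_ ?_
  · have : IntegrableOn (fun x : ℝ => x ^ (1 - α)) (Set.Ioc 0 1) := by
      rw [← intervalIntegrable_iff_integrableOn_Ioc_of_le zero_le_one]
      exact intervalIntegral.intervalIntegrable_rpow' (by linarith)
    refine this.congr_fun (fun y hy => ?_) measurableSet_Ioc
    simp only
    rw [key y hy.1, min_eq_right (by nlinarith [hy.1, hy.2]), ← Real.rpow_natCast y 2,
      ← Real.rpow_add hy.1]
    congr 1; push_cast; ring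
  · refine (integrableOn_Ioi_rpow_of_lt (a := -1 - α) (c := 1) (by linarith) one_pos).congr_fun
      (fun y hy => ?_) measurableSet_Ioi
    have hy' : (1 : ℝ) < y := hy
    simp only
    rw [key y (by linarith), min_eq_left (by nlinarith), one_mul]

lemma hB_nonneg (d : ℕ) (α : ℝ) {y : ℝ} (hy : 0 ≤ y) : 0 ≤ hB d α y := by
  unfold hB; positivity

lemma min_aux (c s : ℝ) (hc : 0 ≤ c) : min 1 (c * s ^ 2) ≤ (1 + c) * min 1 (s ^ 2) := by
  rcases min_cases 1 (s ^ 2) with ⟨h, _⟩ | ⟨h, _⟩ <;> rw [h]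
  · exact (min_le_left _ _).trans (by linarith)
  · exact (min_le_right _ _).trans (by nlinarith [sq_nonneg s])

lemma gI_bound (d : ℕ) (α : ℝ) (φ : ℝ → ℝ) (c : ℝ) (hφ : ∀ s, |φ s| ≤ c * min 1 (s ^ 2))
    (hc : 0 ≤ c) (ξ v z : EuclideanSpace ℝ (Fin d)) :
    ‖gI d α φ ξ v z‖ ≤ c * ((1 + ‖ξ‖ ^ 2) * ‖v‖ ^ 2) * hB d α ‖z‖ := by
  unfold gI hB
  have h0 : 0 ≤ ‖z‖ ^ ((d : ℝ) + α + 2) := by positivity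
  rw [norm_div, norm_mul, Real.norm_eq_abs, Real.norm_eq_abs, Real.norm_eq_abs, abs_of_nonneg h0,
    mul_div_assoc']
  refine div_le_div_of_nonneg_right ?_ h0
  have a1 : |φ ⟪z, ξ⟫| ≤ c * ((1 + ‖ξ‖ ^ 2) * min 1 (‖z‖ ^ 2)) := by
    refine (hφ _).trans (mul_le_mul_of_nonneg_left ?_ hc)
    refine le_trans ?_ (min_aux _ _ (sq_nonneg _))
    refine min_le_min le_rfl ?_
    rw [← mul_pow, mul_comm ‖ξ‖]
    exact sq_le_sq' (neg_le_of_abs_le (abs_real_inner_le_norm z ξ)) (real_inner_le_norm z ξ)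
  have a2 : |⟪z, v⟫ ^ 2| ≤ ‖z‖ ^ 2 * ‖v‖ ^ 2 := by
    rw [abs_of_nonneg (sq_nonneg _), ← mul_pow]
    exact sq_le_sq' (neg_le_of_abs_le (abs_real_inner_le_norm z v)) (real_inner_le_norm z v)
  calc _ ≤ (c * ((1 + ‖ξ‖ ^ 2) * min 1 (‖z‖ ^ 2))) * (‖z‖ ^ 2 * ‖v‖ ^ 2) :=
        mul_le_mul a1 a2 (abs_nonneg _) (by positivity)
    _ = _ := by ring

lemma gI_integrable (d : ℕ) (hd : 1 ≤ d) (α : ℝ) (hα0 : 0 < α) (hα2 : α < 2) (φ : ℝ → ℝ)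
    (hφ : Adm φ) (ξ v : EuclideanSpace ℝ (Fin d)) : Integrable (gI d α φ ξ v) := by
  refine ((hB_integrable d hd α hα0 hα2).const_mul (2 * ((1 + ‖ξ‖ ^ 2) * ‖v‖ ^ 2))).mono' ?_
    (Filter.Eventually.of_forall fun z => gI_bound d α φ 2 hφ.2.2 (by norm_num) ξ v z)
  have := hφ.1
  unfold gI
  refine Measurable.aestronglyMeasurable ?_
  have m1 : Measurable φ := this.measurable
  fun_prop

lemma gK_isom (d : ℕ) (α : ℝ) (φ : ℝ → ℝ) (ξ v : EuclideanSpace ℝ (Fin d))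
    (U : EuclideanSpace ℝ (Fin d) ≃ₗᵢ[ℝ] EuclideanSpace ℝ (Fin d)) :
    gK d α φ (U ξ) (U v) = gK d α φ ξ v := by
  unfold gK
  rw [← (LinearIsometryEquiv.measurePreserving U).integral_comp
    U.toHomeomorph.measurableEmbedding]
  simp [gI, LinearIsometryEquiv.inner_map_map]

lemma gK_neg (d : ℕ) (α : ℝ) (φ : ℝ → ℝ) (hφ : Adm φ) (ξ v : EuclideanSpace ℝ (Fin d)) :
    gK d α φ (-ξ) v = gK d α φ ξ v := by
  simp [gK, gI, inner_neg_right, hφ.2.1]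

lemma gK_swap (d : ℕ) (α : ℝ) (φ : ℝ → ℝ) (ξ v w : EuclideanSpace ℝ (Fin d)) (h : ‖v‖ = ‖w‖)
    (hξ : ⟪ξ, v - w⟫ = 0) : gK d α φ ξ v = gK d α φ ξ w := by
  rw [← gK_isom d α φ ξ v (ℝ ∙ (v - w))ᗮ.reflection, Submodule.reflection_sub h,
    Submodule.reflection_mem_subspace_eq_self]
  rw [Submodule.mem_orthogonal_singleton_iff_inner_left]
  exact hξ

lemma gK_smul (d : ℕ) (α : ℝ) (φ : ℝ → ℝ) (ξ v : EuclideanSpace ℝ (Fin d)) (c : ℝ) :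
    gK d α φ ξ (c • v) = c ^ 2 * gK d α φ ξ v := by
  unfold gK
  rw [← integral_const_mul]
  congr 1; ext z; simp only [gI, inner_smul_right]; ring

lemma gK_decomp (d : ℕ) (hd : 1 ≤ d) (α : ℝ) (hα0 : 0 < α) (hα2 : α < 2) (φ : ℝ → ℝ)
    (hφ : Adm φ) (ξ w : EuclideanSpace ℝ (Fin d)) (c : ℝ) (h : ⟪ξ, w⟫ = 0) :
    gK d α φ ξ (c • ξ + w) = c ^ 2 * gK d α φ ξ ξ + gK d α φ ξ w := by
  have e1 : gK d α φ ξ (c • ξ + w) = gK d α φ ξ (-(c • ξ) + w) := by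
    rw [← gK_isom d α φ ξ (c • ξ + w) (ℝ ∙ ξ)ᗮ.reflection, map_add, map_smul,
      Submodule.reflection_orthogonalComplement_singleton_eq_neg,
      Submodule.reflection_mem_subspace_eq_self, gK_neg _ _ _ hφ, smul_neg]
    rw [Submodule.mem_orthogonal_singleton_iff_inner_right]
    exact h
  have I := fun u => gI_integrable d hd α hα0 hα2 φ hφ ξ u
  have e2 : gK d α φ ξ (c • ξ + w) + gK d α φ ξ (-(c • ξ) + w)
      = 2 * (gK d α φ ξ (c • ξ) + gK d α φ ξ w) := by
    unfold gK
    rw [← integral_add (I _) (I _), ← integral_add (I _) (I _), ← integral_const_mul]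
    congr 1; ext z; simp only [gI, inner_add_right, inner_neg_right]; ring
  rw [gK_smul] at e2
  linarith

lemma gK_scale (d : ℕ) (α : ℝ) (hα0 : 0 < α) (ξ v : EuclideanSpace ℝ (Fin d)) (c : ℝ) :
    gK d α (fun s => 1 - Real.cos s) (c • ξ) v
      = |c| ^ α * gK d α (fun s => 1 - Real.cos s) ξ v := by
  rcases eq_or_ne c 0 with rfl | hc
  · simp [gK, gI, Real.zero_rpow hα0.ne']
  have hc' : 0 < |c| := abs_pos.2 hc
  have e : ∀ z, gI d α (fun s => 1 - Real.cos s) (c • ξ) v z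
      = |c| ^ ((d : ℝ) + α) * gI d α (fun s => 1 - Real.cos s) ξ v (c • z) := by
    intro z
    simp only [gI, inner_smul_right, inner_smul_left, norm_smul, Real.norm_eq_abs]
    rw [Real.mul_rpow (abs_nonneg _) (norm_nonneg _), Real.rpow_add hc' _ 2]
    have h1 : |c| ^ ((d : ℝ) + α) ≠ 0 := (Real.rpow_pos_of_pos hc' _).ne'
    have h2 : |c| ^ (2 : ℝ) = c ^ 2 := by
      rw [show (2 : ℝ) = ((2 : ℕ) : ℝ) by norm_num, Real.rpow_natCast, sq_abs]
    rw [h2]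
    simp only [conj_trivial]
    rcases eq_or_ne (‖z‖ ^ ((d : ℝ) + α + 2)) 0 with h3 | h3
    · simp [h3]
    · field_simp
  unfold gK
  simp only [e]
  rw [integral_const_mul, Measure.integral_comp_smul, finrank_euclideanSpace_fin, smul_eq_mul,
    ← mul_assoc]
  congr 1
  rw [abs_inv, abs_pow, Real.rpow_add hc', Real.rpow_natCast]
  field_simp

lemma gauss_cos (s : ℝ) :
    ∫ x, (1 - Real.cos (x * s)) ∂(ProbabilityTheory.gaussianReal 0 1)
      = 1 - Real.exp (-(s ^ 2 / 2)) := by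
  have h := ProbabilityTheory.charFun_gaussianReal (μ := 0) (v := 1) s
  rw [charFun_apply_real] at h
  have hi : Integrable (fun x : ℝ => Complex.exp ((s : ℂ) * (x : ℂ) * Complex.I))
      (ProbabilityTheory.gaussianReal 0 1) := by
    refine (integrable_const (1 : ℝ)).mono' (by fun_prop) (Filter.Eventually.of_forall fun x => ?_)
    rw [← Complex.ofReal_mul, Complex.norm_exp_ofReal_mul_I]
  have hre := congrArg Complex.re h
  have h2 := integral_re hi
  simp only [RCLike.re_to_complex] at h2
  rw [← h2] at hre
  have e1 : ∀ x : ℝ, (Complex.exp ((s : ℂ) * (x : ℂ) * Complex.I)).re = Real.cos (x * s) := by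
    intro x
    rw [← Complex.ofReal_mul, Complex.exp_ofReal_mul_I_re, mul_comm]
  simp only [e1] at hre
  have e2 : ((s : ℂ) * ((0 : ℝ) : ℂ) * Complex.I - (((1 : NNReal) : ℝ) : ℂ) * (s : ℂ) ^ 2 / 2)
      = ((-(s ^ 2 / 2) : ℝ) : ℂ) := by
    push_cast; ring
  rw [e2, Complex.exp_ofReal_re] at hre
  have hc : Integrable (fun x : ℝ => Real.cos (x * s)) (ProbabilityTheory.gaussianReal 0 1) := by
    refine (integrable_const (1 : ℝ)).mono' (by fun_prop) (Filter.Eventually.of_forall fun x => ?_)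
    exact Real.abs_cos_le_one _
  rw [integral_sub (integrable_const _) hc, hre]
  simp

lemma gK_gauss (d : ℕ) (hd : 1 ≤ d) (α : ℝ) (hα0 : 0 < α) (hα2 : α < 2) :
    ∃ m : ℝ, 0 ≤ m ∧ ∀ ξ v : EuclideanSpace ℝ (Fin d),
      gK d α (fun s => 1 - Real.exp (-(s ^ 2 / 2))) ξ v
        = m * gK d α (fun s => 1 - Real.cos s) ξ v := by
  refine ⟨∫ x, |x| ^ α ∂(ProbabilityTheory.gaussianReal 0 1),
    integral_nonneg fun x => by positivity, fun ξ v => ?_⟩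
  rw [← integral_mul_const]
  simp only [← gK_scale d α hα0]
  unfold gK
  have hint : Integrable (Function.uncurry fun (x : ℝ) (z : EuclideanSpace ℝ (Fin d)) =>
      gI d α (fun s => 1 - Real.cos s) (x • ξ) v z)
      ((ProbabilityTheory.gaussianReal 0 1).prod volume) := by
    have hsq : Integrable (fun x : ℝ => x ^ 2) (ProbabilityTheory.gaussianReal 0 1) := by
      have := (ProbabilityTheory.memLp_id_gaussianReal (μ := 0) (v := 1) 2).integrable_sq
      simpa using this
    have h1 : Integrable (fun x : ℝ => 2 * ((1 + x ^ 2 * ‖ξ‖ ^ 2) * ‖v‖ ^ 2))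
        (ProbabilityTheory.gaussianReal 0 1) :=
      (((integrable_const _).add (hsq.mul_const _)).mul_const _).const_mul _
    refine (h1.mul_prod (hB_integrable d hd α hα0 hα2)).mono' ?_
      (Filter.Eventually.of_forall fun p => ?_)
    · refine Measurable.aestronglyMeasurable ?_
      unfold Function.uncurry gI
      fun_prop
    · have := gI_bound d α _ 2 adm_cos.2.2 (by norm_num) (p.1 • ξ) v p.2
      rw [norm_smul, mul_pow, Real.norm_eq_abs p.1, sq_abs] at this
      exact this
  rw [integral_integral_swap hint]
  congr 1; ext z
  simp only [gI, inner_smul_right]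
  rw [integral_div, integral_mul_const, gauss_cos]

lemma gK_pos (d : ℕ) (hd : 1 ≤ d) (α : ℝ) (hα0 : 0 < α) (hα2 : α < 2)
    (ξ v z₀ : EuclideanSpace ℝ (Fin d)) (h1 : Real.cos ⟪z₀, ξ⟫ ≠ 1) (h2 : ⟪z₀, v⟫ ≠ 0) :
    0 < gK d α (fun s => 1 - Real.cos s) ξ v := by
  unfold gK
  rw [integral_pos_iff_support_of_nonneg _ (gI_integrable d hd α hα0 hα2 _ adm_cos ξ v)]
  · have ho : IsOpen {z : EuclideanSpace ℝ (Fin d) | Real.cos ⟪z, ξ⟫ ≠ 1 ∧ ⟪z, v⟫ ≠ 0} := by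
      refine IsOpen.and ?_ ?_
      · exact isOpen_ne_fun (by fun_prop) (by fun_prop)
      · exact isOpen_ne_fun (by fun_prop) (by fun_prop)
    refine lt_of_lt_of_le (ho.measure_pos volume ⟨z₀, h1, h2⟩) (measure_mono ?_)
    rintro z ⟨hz1, hz2⟩
    have hz : z ≠ 0 := by rintro rfl; simp at hz2
    have := norm_pos_iff.2 hz
    simp only [Function.mem_support, gI]
    have h3 : 1 - Real.cos ⟪z, ξ⟫ ≠ 0 := fun h => hz1 (by linarith)
    positivity
  · intro z
    have := Real.cos_le_one ⟪z, ξ⟫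
    have h3 : 0 ≤ 1 - Real.cos ⟪z, ξ⟫ := by linarith
    simp only [gI, Pi.zero_apply]
    positivity

lemma gK_lt (d : ℕ) (hd : 1 ≤ d) (α : ℝ) (hα0 : 0 < α) (hα2 : α < 2)
    (ξ v : EuclideanSpace ℝ (Fin d)) (hξ : ‖ξ‖ = 1) (hv : ‖v‖ = 1) (hξv : ⟪ξ, v⟫ = 0) :
    gK d α (fun s => 1 - Real.cos s) ξ v < gK d α (fun s => 1 - Real.cos s) ξ ξ := by
  obtain ⟨m, hm, hmK⟩ := gK_gauss d hd α hα0 hα2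
  set φ : ℝ → ℝ := fun s => 1 - Real.exp (-(s ^ 2 / 2)) with hφ
  have s1 : (ℝ ∙ (ξ - v))ᗮ.reflection ξ = v := Submodule.reflection_sub (hξ.trans hv.symm)
  have s2 : (ℝ ∙ (ξ - v))ᗮ.reflection v = ξ := by
    have h := congrArg (ℝ ∙ (ξ - v))ᗮ.reflection s1
    rw [Submodule.reflection_reflection] at h
    exact h.symm
  have e1 := gK_isom d α φ ξ ξ (ℝ ∙ (ξ - v))ᗮ.reflection
  have e2 := gK_isom d α φ ξ v (ℝ ∙ (ξ - v))ᗮ.reflection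
  rw [s1] at e1 e2
  rw [s2] at e2
  have I := fun x u => gI_integrable d hd α hα0 hα2 φ adm_exp x u
  have key : 0 < (gK d α φ ξ ξ - gK d α φ ξ v) + (gK d α φ v v - gK d α φ v ξ) := by
    have hI := ((I ξ ξ).sub (I ξ v)).add ((I v v).sub (I v ξ))
    have : (gK d α φ ξ ξ - gK d α φ ξ v) + (gK d α φ v v - gK d α φ v ξ)
        = ∫ z, ((gI d α φ ξ ξ - gI d α φ ξ v) + (gI d α φ v v - gI d α φ v ξ)) z := by
      unfold gK
      rw [integral_add' ((I ξ ξ).sub (I ξ v)) ((I v v).sub (I v ξ)), integral_sub' (I _ _) (I _ _),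
        integral_sub' (I _ _) (I _ _)]
    rw [this]
    have hform : ∀ z, ((gI d α φ ξ ξ - gI d α φ ξ v) + (gI d α φ v v - gI d α φ v ξ)) z
        = (Real.exp (-(⟪z, v⟫ ^ 2 / 2)) - Real.exp (-(⟪z, ξ⟫ ^ 2 / 2))) *
          (⟪z, ξ⟫ ^ 2 - ⟪z, v⟫ ^ 2) / ‖z‖ ^ ((d : ℝ) + α + 2) := by
      intro z
      simp only [Pi.add_apply, Pi.sub_apply, gI, hφ]
      ring
    have hmono : ∀ x y : ℝ, x ≠ y →
        0 < (Real.exp (-(y / 2)) - Real.exp (-(x / 2))) * (x - y) := by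
      intro x y hxy
      rcases lt_or_gt_of_ne hxy with h | h
      · exact mul_pos_of_neg_of_neg (sub_neg.2 (Real.exp_lt_exp.2 (by linarith))) (by linarith)
      · exact mul_pos (sub_pos.2 (Real.exp_lt_exp.2 (by linarith))) (by linarith)
    rw [integral_pos_iff_support_of_nonneg _ hI]
    · have ho : IsOpen {z : EuclideanSpace ℝ (Fin d) | ⟪z, ξ⟫ ^ 2 ≠ ⟪z, v⟫ ^ 2} :=
        isOpen_ne_fun (by fun_prop) (by fun_prop)
      refine lt_of_lt_of_le (ho.measure_pos volume ⟨ξ, ?_⟩) (measure_mono ?_)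
      · simp [hξv, hξ]
      · intro z hz
        have hz0 : z ≠ 0 := by rintro rfl; simp at hz
        have := norm_pos_iff.2 hz0
        rw [Function.mem_support, hform]
        exact (div_pos (hmono _ _ hz) (by positivity)).ne'
    · intro z
      rw [hform, Pi.zero_apply]
      refine div_nonneg ?_ (by positivity)
      rcases eq_or_ne (⟪z, ξ⟫ ^ 2) (⟪z, v⟫ ^ 2) with h | h
      · simp [h]
      · exact (hmono _ _ h).le
  rw [e1, e2, hmK, hmK] at key
  by_contra hcon
  push Not at hcon
  nlinarith [mul_le_mul_of_nonneg_left hcon hm]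

/-- The key structural fact on rank-one matrices. -/
lemma gK_main (d : ℕ) (hd : 1 ≤ d) (α : ℝ) (hα0 : 0 < α) (hα2 : α < 2) :
    ∃ C c : ℝ, 0 < C ∧ 0 < c ∧ ∀ ξ v : EuclideanSpace ℝ (Fin d), ‖ξ‖ = 1 →
      gK d α (fun s => 1 - Real.cos s) ξ v = C * ‖v‖ ^ 2 + c * ⟪v, ξ⟫ ^ 2 := by
  set φ : ℝ → ℝ := fun s => 1 - Real.cos s with hφ
  set e : EuclideanSpace ℝ (Fin d) := EuclideanSpace.single ⟨0, hd⟩ 1 with he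
  have hen : ‖e‖ = 1 := by simp [he]
  have hcos1 : Real.cos 1 ≠ 1 := (Real.cos_one_le.trans_lt (by norm_num)).ne
  have hD : ∀ ξ : EuclideanSpace ℝ (Fin d), ‖ξ‖ = 1 → gK d α φ ξ ξ = gK d α φ e e := by
    intro ξ hξ
    rw [← gK_isom d α φ ξ ξ (ℝ ∙ (ξ - e))ᗮ.reflection,
      Submodule.reflection_sub (hξ.trans hen.symm)]
  have hDpos : 0 < gK d α φ e e := by
    refine gK_pos d hd α hα0 hα2 e e e ?_ ?_ <;> simp [hen, hcos1]
  -- decomposition of a vector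
  have hdec : ∀ ξ v : EuclideanSpace ℝ (Fin d), ‖ξ‖ = 1 → ∃ w, ⟪ξ, w⟫ = 0 ∧
      v = ⟪v, ξ⟫ • ξ + w ∧ ‖v‖ ^ 2 = ⟪v, ξ⟫ ^ 2 + ‖w‖ ^ 2 := by
    intro ξ v hξ
    have h0 : ⟪ξ, v - ⟪v, ξ⟫ • ξ⟫ = 0 := by
      rw [inner_sub_right, inner_smul_right, real_inner_self_eq_norm_sq, hξ, real_inner_comm]
      simp
    refine ⟨v - ⟪v, ξ⟫ • ξ, h0, by simp, ?_⟩
    rw [norm_sub_sq_real, inner_smul_right, norm_smul, hξ, Real.norm_eq_abs, mul_one, sq_abs]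
    ring
  by_cases hex : ∃ f : EuclideanSpace ℝ (Fin d), ‖f‖ = 1 ∧ ⟪e, f⟫ = 0
  · obtain ⟨f, hf, hef⟩ := hex
    have hA : 0 < gK d α φ e f := by
      refine gK_pos d hd α hα0 hα2 e f (e + f) ?_ ?_
      · simp [inner_add_left, hen, real_inner_comm e f, hef, hcos1]
      · simp [inner_add_left, hf, hef]
    refine ⟨gK d α φ e f, gK d α φ e e - gK d α φ e f, hA,
      sub_pos.2 (gK_lt d hd α hα0 hα2 e f hen hf hef), fun ξ v hξ => ?_⟩
    obtain ⟨w, hw, hvw, hn⟩ := hdec ξ v hξ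
    have hW : gK d α φ ξ w = ‖w‖ ^ 2 * gK d α φ e f := by
      rw [← gK_smul, ← gK_isom d α φ ξ w (ℝ ∙ (ξ - e))ᗮ.reflection,
        Submodule.reflection_sub (hξ.trans hen.symm)]
      refine gK_swap d α φ e _ _ ?_ ?_
      · rw [LinearIsometryEquiv.norm_map, norm_smul, hf]; simp
      · rw [inner_sub_right, inner_smul_right, hef, mul_zero, sub_zero]
        nth_rewrite 1 [← Submodule.reflection_sub (hξ.trans hen.symm)]
        rw [LinearIsometryEquiv.inner_map_map, hw]
    rw [hn]
    conv_lhs => rw [hvw]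
    rw [gK_decomp d hd α hα0 hα2 φ adm_cos ξ w _ hw, hD ξ hξ, hW]
    ring
  · push Not at hex
    refine ⟨gK d α φ e e / 2, gK d α φ e e / 2, by linarith, by linarith, fun ξ v hξ => ?_⟩
    obtain ⟨w, hw, hvw, hn⟩ := hdec ξ v hξ
    have hw0 : w = 0 := by
      by_contra hne
      refine hex ((‖w‖⁻¹ • (ℝ ∙ (ξ - e))ᗮ.reflection w)) ?_ ?_
      · rw [norm_smul, LinearIsometryEquiv.norm_map, norm_inv, norm_norm,
          inv_mul_cancel₀ (norm_ne_zero_iff.2 hne)]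
      · rw [inner_smul_right]
        nth_rewrite 1 [← Submodule.reflection_sub (hξ.trans hen.symm)]
        rw [LinearIsometryEquiv.inner_map_map, hw, mul_zero]
    rw [hn]
    conv_lhs => rw [hvw]
    rw [gK_decomp d hd α hα0 hα2 φ adm_cos ξ w _ hw, hD ξ hξ, hw0]
    simp [gK, gI]
    ring

open scoped MatrixOrder in
lemma psd_factor {d : ℕ} (a : Matrix (Fin d) (Fin d) ℝ) (h : a.PosSemidef) :
    ∃ b : Matrix (Fin d) (Fin d) ℝ, a = b.transpose * b := by
  obtain ⟨b, hb⟩ := CStarAlgebra.nonneg_iff_eq_star_mul_self.1 (Matrix.nonneg_iff_posSemidef.2 h)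
  refine ⟨b, hb.trans ?_⟩
  rw [Matrix.star_eq_conjTranspose, Matrix.conjTranspose_eq_transpose_of_trivial]

lemma quad_factor {d : ℕ} (b : Matrix (Fin d) (Fin d) ℝ) (z : EuclideanSpace ℝ (Fin d)) :
    ∑ i, (b.transpose * b).mulVec z i * z i
      = ∑ k, ⟪z, (WithLp.toLp 2 (b k) : EuclideanSpace ℝ (Fin d))⟫ ^ 2 := by
  have h1 : ∑ i, (b.transpose * b).mulVec z i * z i
      = dotProduct ((b.transpose * b).mulVec z) z := rfl
  rw [h1, ← Matrix.mulVec_mulVec, Matrix.mulVec_transpose, ← Matrix.dotProduct_mulVec]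
  simp only [dotProduct]
  refine Finset.sum_congr rfl fun k _ => ?_
  rw [sq]
  have : b.mulVec z k = ⟪z, (WithLp.toLp 2 (b k) : EuclideanSpace ℝ (Fin d))⟫ := by
    simp [Matrix.mulVec, dotProduct, PiLp.inner_apply]
  rw [this]

lemma trace_factor {d : ℕ} (b : Matrix (Fin d) (Fin d) ℝ) :
    (b.transpose * b).trace = ∑ k, ‖(WithLp.toLp 2 (b k) : EuclideanSpace ℝ (Fin d))‖ ^ 2 := by
  simp only [Matrix.trace, Matrix.diag, Matrix.mul_apply, Matrix.transpose_apply,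
    EuclideanSpace.norm_sq_eq]
  rw [Finset.sum_comm]
  simp [sq]

/-- For every `d ≥ 1` and `α ∈ (0,2)` there exist constants
`C_{d,α} > 0` and `c_{d,α} > 0`, depending only on `d` and `α`, such that for
every real symmetric positive semidefinite matrix `a` and every `ξ ≠ 0`,
`q(ξ; a) = C_{d,α}·Tr(a)·‖ξ‖^α + c_{d,α}·⟨a ξ̂, ξ̂⟩·‖ξ‖^α`, where `ξ̂ = ξ/‖ξ‖`. -/
theorem stmt_5 (d : ℕ) (hd : 1 ≤ d) (α : ℝ) (hα0 : 0 < α) (hα2 : α < 2) :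
    ∃ C c : ℝ, 0 < C ∧ 0 < c ∧
      ∀ (a : Matrix (Fin d) (Fin d) ℝ), a.IsSymm → a.PosSemidef →
        ∀ ξ : EuclideanSpace ℝ (Fin d), ξ ≠ 0 →
          stableSymbol d α a ξ =
            C * a.trace * ‖ξ‖ ^ α +
              c * (∑ i, a.mulVec (‖ξ‖⁻¹ • ξ) i * (‖ξ‖⁻¹ • ξ) i) * ‖ξ‖ ^ α := by
  obtain ⟨C, c, hC, hc, hK⟩ := gK_main d hd α hα0 hα2
  refine ⟨C, c, hC, hc, fun a _ ha ξ hξ => ?_⟩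
  obtain ⟨b, rfl⟩ := psd_factor a ha
  have hn : ‖ξ‖ ≠ 0 := norm_ne_zero_iff.2 hξ
  have hu : ‖‖ξ‖⁻¹ • ξ‖ = 1 := by rw [norm_smul, norm_inv, norm_norm, inv_mul_cancel₀ hn]
  have h1 : stableSymbol d α (b.transpose * b) ξ
      = ∑ k, gK d α (fun s => 1 - Real.cos s) ξ (WithLp.toLp 2 (b k)) := by
    unfold stableSymbol gK
    rw [← integral_finsetSum _ fun k _ => gI_integrable d hd α hα0 hα2 _ adm_cos ξ _]
    congr 1; ext z
    rw [quad_factor, Finset.mul_sum, Finset.sum_div]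
    rfl
  have h2 : ∀ v, gK d α (fun s => 1 - Real.cos s) ξ v
      = ‖ξ‖ ^ α * (C * ‖v‖ ^ 2 + c * ⟪v, ‖ξ‖⁻¹ • ξ⟫ ^ 2) := by
    intro v
    rw [← hK _ v hu]
    have := gK_scale d α hα0 (‖ξ‖⁻¹ • ξ) v ‖ξ‖
    rwa [smul_inv_smul₀ hn, abs_norm] at this
  have h3 := quad_factor b (‖ξ‖⁻¹ • ξ)
  rw [h1, trace_factor]
  simp only [h2]
  rw [← Finset.mul_sum, Finset.sum_add_distrib, ← Finset.mul_sum, ← Finset.mul_sum]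
  simp only [real_inner_comm (‖ξ‖⁻¹ • ξ)] at h3 ⊢
  erw [h3]
  ring
end

section
/- Let X be a Polish space, τ : ℝ^d × X → X a jointly continuous action of the additive group (ℝ^d, +) on X, and μ a Borel probability measure on X that is invariant and ergodic for this action. Then there exists a point x̄ ∈ X such that the probability measures μ_M, defined as the pushforward of the normalized Lebesgue measure ℓ_M on Q_M under the map y ↦ τ(y, x̄), converge weakly to μ as the integer M tends to infinity; that is, ∫_{Q_M} F(τ(y, x̄)) ℓ_M(dy) → ∫_X F dμ for every bounded continuous F : X → ℝ. -/
open MeasureTheory Filter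

/-- The cube `Q_M = [−M/2, M/2]^d` in `ℝ^d`. -/
def cubeQ (d : ℕ) (M : ℝ) : Set (Fin d → ℝ) :=
  Set.pi Set.univ fun _ : Fin d => Set.Icc (-M / 2) (M / 2)

lemma cubeQ_eq (d : ℕ) (M : ℝ) (hM : 0 ≤ M) : cubeQ d M = Metric.closedBall (0 : Fin d → ℝ) (M / 2) := by
  rw [closedBall_pi _ (by positivity)]
  simp only [cubeQ, Pi.zero_apply, Real.closedBall_eq_Icc, zero_sub, zero_add, neg_div]

lemma vol_cb (d : ℕ) (a : Fin d → ℝ) {r : ℝ} (hr : 0 ≤ r) :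
    volume (Metric.closedBall a r) = ENNReal.ofReal (2 * r) ^ d := by
  rw [Real.volume_pi_closedBall a hr, Fintype.card_fin, ENNReal.ofReal_pow (by positivity)]

/-- Vitali-type maximal estimate on `ℝ^d`. -/
lemma vitali_max (d N : ℕ) (G : (Fin d → ℝ) → ENNReal) (lam : ENNReal)
    (E : Set (Fin d → ℝ)) (hE : E ⊆ Metric.closedBall 0 ((N : ℝ) / 2))
    (h : ∀ y ∈ E, ∃ M : ℕ, 1 ≤ M ∧ M ≤ N ∧
      lam * (M : ENNReal) ^ d ≤ ∫⁻ z in Metric.closedBall y ((M : ℝ) / 2), G z) :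
    lam * volume E ≤ 5 ^ d * ∫⁻ z in Metric.closedBall 0 (N : ℝ), G z := by
  choose! M h1 h2 h3 using h
  obtain ⟨u, hut, hdis, hcov⟩ := Vitali.exists_disjoint_subfamily_covering_enlargement_closedBall
    E (fun y => y) (fun y => (M y : ℝ) / 2) ((N : ℝ) / 2)
    (fun a ha => by have : (M a : ℝ) ≤ N := by exact_mod_cast h2 a ha
                    linarith) 5 (by norm_num)
  have hpos : ∀ a ∈ E, (0 : ℝ) < (M a : ℝ) / 2 := fun a ha => by
    have : (1 : ℝ) ≤ M a := by exact_mod_cast h1 a ha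
    linarith
  have hcount : u.Countable := hdis.countable_of_nonempty_interior fun a ha => by
    refine ⟨a, ?_⟩
    exact Metric.ball_subset_interior_closedBall (Metric.mem_ball_self (hpos a (hut ha)))
  have hsub : E ⊆ ⋃ b ∈ u, Metric.closedBall b (5 * ((M b : ℝ) / 2)) := by
    intro a ha
    obtain ⟨b, hb, hab⟩ := hcov a ha
    exact Set.mem_biUnion hb (hab (Metric.mem_closedBall_self (hpos a ha).le))
  have hv : ∀ b ∈ u, volume (Metric.closedBall b (5 * ((M b : ℝ) / 2))) = 5 ^ d * (M b : ENNReal) ^ d := by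
    intro b hb
    rw [vol_cb _ _ (by positivity), ← mul_pow]
    congr 1
    rw [show (2 : ℝ) * (5 * ((M b : ℝ) / 2)) = 5 * M b by ring, ENNReal.ofReal_mul (by norm_num)]
    simp
  have hsub2 : (⋃ b ∈ u, Metric.closedBall b ((M b : ℝ) / 2)) ⊆ Metric.closedBall 0 (N : ℝ) := by
    refine Set.iUnion₂_subset fun b hb => ?_
    refine Metric.closedBall_subset_closedBall' ?_
    have h4 : (M b : ℝ) ≤ N := by exact_mod_cast h2 b (hut hb)
    have h5 := Metric.mem_closedBall.1 (hE (hut hb))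
    linarith
  have := hcount.to_subtype
  calc lam * volume E ≤ lam * ∑' b : u, volume (Metric.closedBall (b : Fin d → ℝ) (5 * ((M b : ℝ) / 2))) := by
        gcongr
        exact (measure_mono hsub).trans (measure_biUnion_le _ hcount _)
    _ = ∑' b : u, 5 ^ d * (lam * (M b : ENNReal) ^ d) := by
        rw [← ENNReal.tsum_mul_left]
        refine tsum_congr fun b => ?_
        rw [hv b b.2]; ring
    _ ≤ ∑' b : u, 5 ^ d * ∫⁻ z in Metric.closedBall (b : Fin d → ℝ) ((M b : ℝ) / 2), G z := by
        refine ENNReal.tsum_le_tsum fun b => ?_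
        gcongr
        exact h3 b (hut b.2)
    _ = 5 ^ d * ∫⁻ z in ⋃ b ∈ u, Metric.closedBall b ((M b : ℝ) / 2), G z := by
        rw [ENNReal.tsum_mul_left, lintegral_biUnion hcount (fun _ _ => Metric.isClosed_closedBall.measurableSet) hdis]
    _ ≤ _ := by
        gcongr

section
variable {X : Type*} [MeasurableSpace X] {d : ℕ}
    {τ : (Fin d → ℝ) × X → X} (hτm : Measurable τ)
    (hτadd : ∀ (y y' : Fin d → ℝ) (x : X), τ (y + y', x) = τ (y, τ (y', x)))
    {μ : Measure X} [IsProbabilityMeasure μ]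
    (hmp : ∀ y : Fin d → ℝ, MeasurePreserving (fun x => τ (y, x)) μ μ)

include hτadd in
lemma shift_lint (g : X → ENNReal) (x : X) (y : Fin d → ℝ) (M : ℝ) (hM : 0 ≤ M) :
    ∫⁻ z in cubeQ d M, g (τ (z, τ (y, x))) = ∫⁻ z in Metric.closedBall y (M / 2), g (τ (z, x)) := by
  have h := (measurePreserving_add_right (volume : Measure (Fin d → ℝ)) y).setLIntegral_comp_preimage_emb
    (MeasurableEquiv.addRight y).measurableEmbedding (fun z => g (τ (z, x))) (Metric.closedBall y (M / 2))
  rw [← h, cubeQ_eq d M hM]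
  simp only [hτadd]
  congr 2
  ext z
  simp [Metric.mem_closedBall, dist_eq_norm]

include hτm hτadd hmp in
/-- Wiener's maximal inequality. -/
lemma maximal_N (g : X → ENNReal) (hg : Measurable g) (lam : ENNReal) (N : ℕ) (hN : 1 ≤ N) :
    lam * μ {x | ∃ M : ℕ, 1 ≤ M ∧ M ≤ N ∧
      lam * (M : ENNReal) ^ d ≤ ∫⁻ z in cubeQ d M, g (τ (z, x))} ≤ 10 ^ d * ∫⁻ x, g x ∂μ := by
  set E := {x | ∃ M : ℕ, 1 ≤ M ∧ M ≤ N ∧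
      lam * (M : ENNReal) ^ d ≤ ∫⁻ z in cubeQ d M, g (τ (z, x))} with hE
  have hgm : Measurable fun p : X × (Fin d → ℝ) => g (τ (p.2, p.1)) :=
    hg.comp (hτm.comp measurable_swap)
  have hEm : MeasurableSet E := by
    have : E = ⋃ M : ℕ, {x | 1 ≤ M ∧ M ≤ N ∧
      lam * (M : ENNReal) ^ d ≤ ∫⁻ z in cubeQ d M, g (τ (z, x))} := by
      ext x; simp [hE]
    rw [this]
    refine MeasurableSet.iUnion fun M => ?_
    refine (MeasurableSet.const _).inter ((MeasurableSet.const _).inter ?_)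
    exact measurableSet_le measurable_const (hgm.lintegral_prod_right')
  set Q := Metric.closedBall (0 : Fin d → ℝ) ((N : ℝ) / 2) with hQ
  have hQm : MeasurableSet Q := Metric.isClosed_closedBall.measurableSet
  have key : ∀ x, lam * (∫⁻ y in Q, E.indicator 1 (τ (y, x))) ≤
      5 ^ d * ∫⁻ z in Metric.closedBall 0 (N : ℝ), g (τ (z, x)) := by
    intro x
    have hS : MeasurableSet ((fun y => τ (y, x)) ⁻¹' E) := (hτm.comp measurable_prodMk_right) hEm
    have : ∫⁻ y in Q, E.indicator 1 (τ (y, x)) = volume ((fun y => τ (y, x)) ⁻¹' E ∩ Q) := by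
      rw [← Measure.restrict_apply hS, ← lintegral_indicator_one hS]
      rfl
    rw [this]
    refine vitali_max d N (fun z => g (τ (z, x))) lam _ Set.inter_subset_right ?_
    rintro y ⟨⟨M, h1, h2, h3⟩, -⟩
    refine ⟨M, h1, h2, ?_⟩
    rwa [shift_lint hτadd g x y M (by positivity)] at h3
  have hint := lintegral_mono (μ := μ) key
  have hEi : Measurable (E.indicator (1 : X → ENNReal)) := measurable_one.indicator hEm
  have him : Measurable fun p : X × (Fin d → ℝ) => E.indicator (1 : X → ENNReal) (τ (p.2, p.1)) :=
    hEi.comp (hτm.comp measurable_swap)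
  rw [lintegral_const_mul _ him.lintegral_prod_right',
    lintegral_const_mul _ hgm.lintegral_prod_right', 
    lintegral_lintegral_swap (f := fun x y => E.indicator (1 : X → ENNReal) (τ (y, x)))
      him.aemeasurable,
    lintegral_lintegral_swap (f := fun x y => g (τ (y, x))) hgm.aemeasurable] at hint
  have e1 : ∀ y, ∫⁻ x, E.indicator (1 : X → ENNReal) (τ (y, x)) ∂μ = μ E := fun y => by
    rw [(hmp y).lintegral_comp hEi, lintegral_indicator_one hEm]
  have e2 : ∀ y, ∫⁻ x, g (τ (y, x)) ∂μ = ∫⁻ x, g x ∂μ := fun y => (hmp y).lintegral_comp hg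
  simp only [e1, e2, lintegral_const, Measure.restrict_apply_univ] at hint
  rw [hQ, vol_cb _ _ (by positivity), vol_cb _ _ (by positivity)] at hint
  have hN0 : (N : ENNReal) ^ d ≠ 0 := by
    have : (N : ENNReal) ≠ 0 := by exact_mod_cast (by omega : N ≠ 0)
    exact pow_ne_zero _ this
  have hNt : (N : ENNReal) ^ d ≠ ⊤ := ENNReal.pow_ne_top (ENNReal.natCast_ne_top N)
  have a1 : ENNReal.ofReal (2 * ((N : ℝ) / 2)) = N := by
    rw [show 2 * ((N : ℝ) / 2) = N by ring]; simp
  have a2 : ENNReal.ofReal (2 * (N : ℝ)) = 2 * N := by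
    rw [ENNReal.ofReal_mul (by norm_num)]; simp
  rw [a1, a2, mul_pow, ← mul_assoc, show (5 : ENNReal) ^ d * ((∫⁻ x, g x ∂μ) * (2 ^ d * (N : ENNReal) ^ d))
    = 10 ^ d * (∫⁻ x, g x ∂μ) * (N : ENNReal) ^ d by
      rw [show (10 : ENNReal) = 5 * 2 by norm_num, mul_pow]; ring] at hint
  exact (ENNReal.mul_le_mul_iff_left hN0 hNt).1 hint

include hτm hτadd hmp in
lemma maximal (g : X → ENNReal) (hg : Measurable g) (lam : ENNReal) :
    lam * μ {x | ∃ M : ℕ, 1 ≤ M ∧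
      lam * (M : ENNReal) ^ d ≤ ∫⁻ z in cubeQ d M, g (τ (z, x))} ≤ 10 ^ d * ∫⁻ x, g x ∂μ := by
  set E : ℕ → Set X := fun N => {x | ∃ M : ℕ, 1 ≤ M ∧ M ≤ N + 1 ∧
      lam * (M : ENNReal) ^ d ≤ ∫⁻ z in cubeQ d M, g (τ (z, x))} with hE
  have : {x | ∃ M : ℕ, 1 ≤ M ∧
      lam * (M : ENNReal) ^ d ≤ ∫⁻ z in cubeQ d M, g (τ (z, x))} = ⋃ N, E N := by
    ext x
    simp only [Set.mem_ofPred_eq, hE, Set.mem_iUnion]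
    constructor
    · rintro ⟨M, h1, h2⟩; exact ⟨M, M, h1, by omega, h2⟩
    · rintro ⟨N, M, h1, -, h2⟩; exact ⟨M, h1, h2⟩
  have hmono : Monotone E := by
    rintro a b hab x ⟨M, h1, h2, h3⟩
    exact ⟨M, h1, by omega, h3⟩
  rw [this, hmono.measure_iUnion, ENNReal.mul_iSup]
  exact iSup_le fun N => maximal_N hτm hτadd hmp g hg lam (N + 1) (by omega)
end
lemma shift_int (d : ℕ) (G : (Fin d → ℝ) → ℝ) (w : Fin d → ℝ) (r : ℝ) :
    ∫ z in Metric.closedBall 0 r, G (z + w) = ∫ z in Metric.closedBall w r, G z := by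
  have h := (measurePreserving_add_right (volume : Measure (Fin d → ℝ)) w).setIntegral_preimage_emb
    (MeasurableEquiv.addRight w).measurableEmbedding G (Metric.closedBall w r)
  rw [← h]
  congr 2
  ext z
  simp [Metric.mem_closedBall, dist_eq_norm]

lemma cob_tendsto (d : ℕ) (G : (Fin d → ℝ) → ℝ) (hG : Measurable G) (h0 : ∀ z, 0 ≤ G z)
    (h1 : ∀ z, G z ≤ 1) (w : Fin d → ℝ) :
    Tendsto (fun M : ℕ => ((M : ℝ) ^ d)⁻¹ * ∫ z in cubeQ d (M : ℝ), (G z - G (z + w)))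
      atTop (nhds 0) := by
  have hint : ∀ a r, IntegrableOn G (Metric.closedBall a r) := fun a r => by
    refine Measure.integrableOn_of_bounded (M := 1) (isCompact_closedBall a r).measure_lt_top.ne
      hG.aestronglyMeasurable (ae_of_all _ fun z => ?_)
    rw [Real.norm_of_nonneg (h0 z)]; exact h1 z
  have hvol : ∀ r : ℝ, 0 ≤ r → volume.real (Metric.closedBall (0 : Fin d → ℝ) r) = (2 * r) ^ d := by
    intro r hr
    rw [measureReal_def, vol_cb _ _ hr, ENNReal.toReal_pow, ENNReal.toReal_ofReal (by positivity)]
  have hbd : ∀ r, ∀ a : Fin d → ℝ, ‖a‖ ≤ ‖w‖ → ‖w‖ ≤ r →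
      (∫ z in Metric.closedBall 0 (r - ‖w‖), G z) ≤ ∫ z in Metric.closedBall a r, G z ∧
      (∫ z in Metric.closedBall a r, G z) ≤ ∫ z in Metric.closedBall 0 (r + ‖w‖), G z := by
    intro r a ha hr
    constructor
    · refine setIntegral_mono_set (hint _ _) (ae_of_all _ h0) (LE.le.eventuallyLE ?_)
      refine Metric.closedBall_subset_closedBall' ?_
      rw [dist_comm, dist_zero_right]; linarith
    · refine setIntegral_mono_set (hint _ _) (ae_of_all _ h0) (LE.le.eventuallyLE ?_)
      refine Metric.closedBall_subset_closedBall' ?_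
      rw [dist_zero_right]; linarith
  have hdiff : ∀ r, ‖w‖ ≤ r → (∫ z in Metric.closedBall 0 (r + ‖w‖), G z)
      - (∫ z in Metric.closedBall 0 (r - ‖w‖), G z) ≤ (2 * (r + ‖w‖)) ^ d - (2 * (r - ‖w‖)) ^ d := by
    intro r hr
    have hw := norm_nonneg w
    have hsub : Metric.closedBall (0 : Fin d → ℝ) (r - ‖w‖) ⊆ Metric.closedBall 0 (r + ‖w‖) :=
      Metric.closedBall_subset_closedBall (by linarith)
    rw [← setIntegral_sdiff Metric.isClosed_closedBall.measurableSet (hint _ _) hsub]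
    rw [← hvol _ (by linarith), ← hvol _ (by linarith),
      ← measureReal_sdiff hsub Metric.isClosed_closedBall.measurableSet
        (isCompact_closedBall _ _).measure_lt_top.ne]
    have := setIntegral_mono_on (μ := volume) ((hint 0 (r + ‖w‖)).mono_set (Set.sdiff_subset (t := Metric.closedBall 0 (r - ‖w‖))))
      (g := fun _ => (1 : ℝ)) (integrableOn_const
        ((measure_mono Set.sdiff_subset).trans_lt (isCompact_closedBall _ _).measure_lt_top).ne)
      (Metric.isClosed_closedBall.measurableSet.diff Metric.isClosed_closedBall.measurableSet)
      (fun z _ => h1 z)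
    simpa using this
  have hlim : Tendsto (fun M : ℕ => (1 + (2 * ‖w‖) / (M : ℝ)) ^ d - (1 - (2 * ‖w‖) / (M : ℝ)) ^ d)
      atTop (nhds 0) := by
    have h := tendsto_const_div_atTop_nhds_zero_nat (2 * ‖w‖)
    have := ((h.const_add 1).pow d).sub ((h.const_sub 1).pow d)
    simpa using this
  refine squeeze_zero_norm' ?_ hlim
  obtain ⟨K, hK⟩ := exists_nat_ge (2 * ‖w‖)
  filter_upwards [eventually_ge_atTop K, eventually_ge_atTop 1] with M hM hM1
  have hM' : (K : ℝ) ≤ M := by exact_mod_cast hM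
  have hM1' : (1 : ℝ) ≤ M := by exact_mod_cast hM1
  have hp : (0 : ℝ) < (M : ℝ) ^ d := by positivity
  rw [cubeQ_eq _ _ (by positivity)]
  have hint2 : IntegrableOn (fun z => G (z + w)) (Metric.closedBall 0 ((M : ℝ) / 2)) := by
    refine Measure.integrableOn_of_bounded (M := 1) (isCompact_closedBall _ _).measure_lt_top.ne
      (hG.comp (measurable_add_const w)).aestronglyMeasurable (ae_of_all _ fun z => ?_)
    rw [Real.norm_of_nonneg (h0 _)]; exact h1 _
  rw [integral_sub (hint _ _) hint2, shift_int]
  obtain ⟨a1, a2⟩ := hbd ((M : ℝ) / 2) 0 (by simp) (by linarith)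
  obtain ⟨b1, b2⟩ := hbd ((M : ℝ) / 2) w le_rfl (by linarith)
  have c := hdiff ((M : ℝ) / 2) (by linarith)
  rw [norm_mul, norm_inv, Real.norm_of_nonneg hp.le, inv_mul_le_iff₀ hp, mul_sub, ← mul_pow, ← mul_pow,
    mul_add, mul_sub, mul_one, mul_div_cancel₀ _ (by positivity)]
  rw [show 2 * ((M : ℝ) / 2 + ‖w‖) = M + 2 * ‖w‖ by ring,
    show 2 * ((M : ℝ) / 2 - ‖w‖) = M - 2 * ‖w‖ by ring] at c
  rw [Real.norm_eq_abs, abs_le]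
  constructor <;> linarith

section
variable {X : Type*} [MeasurableSpace X] {d : ℕ}
    {τ : (Fin d → ℝ) × X → X} (hτm : Measurable τ)
    (hτzero : ∀ x, τ (0, x) = x)
    (hτadd : ∀ (y y' : Fin d → ℝ) (x : X), τ (y + y', x) = τ (y, τ (y', x)))
    {μ : Measure X} [IsProbabilityMeasure μ]
    (hmp : ∀ y : Fin d → ℝ, MeasurePreserving (fun x => τ (y, x)) μ μ)
    (herg : ∀ A : Set X, MeasurableSet A →
      (∀ y : Fin d → ℝ, (fun x => τ (y, x)) ⁻¹' A = A) → μ A = 0 ∨ μ A = 1)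

include hτm hτadd herg in
lemma inv_const (g : X → ℝ) (hg : Measurable g)
    (hinv : ∀ y, ∀ᵐ x ∂μ, g (τ (y, x)) = g x) : ∃ c : ℝ, g =ᵐ[μ] fun _ => c := by
  have hae : ∀ᵐ x ∂μ, ∀ᵐ y : Fin d → ℝ, g (τ (y, x)) = g x := by
    rw [Measure.ae_ae_comm]
    · exact ae_of_all _ hinv
    · exact measurableSet_eq_fun (hg.comp (hτm.comp measurable_swap)) (hg.comp measurable_fst)
  refine exists_eventuallyEq_const_of_forall_separating (l := ae μ) MeasurableSet fun s hs => ?_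
  set A : Set X := {x | ∀ᵐ y : Fin d → ℝ, g (τ (y, x)) ∈ s} with hA
  have hAm : MeasurableSet A := by
    have hS : MeasurableSet {p : X × (Fin d → ℝ) | g (τ (p.2, p.1)) ∉ s} :=
      ((hg.comp (hτm.comp measurable_swap)) hs).compl
    exact (measurable_measure_prodMk_left (ν := (volume : Measure (Fin d → ℝ))) hS) (measurableSet_singleton 0)
  have hAs : ∀ᵐ x ∂μ, x ∈ A ↔ g x ∈ s := by
    filter_upwards [hae] with x hx
    constructor
    · intro h
      obtain ⟨y, hy1, hy2⟩ := (hx.and h).exists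
      rwa [← hy1]
    · intro h
      show ∀ᵐ y : Fin d → ℝ, g (τ (y, x)) ∈ s
      filter_upwards [hx] with y hy
      rwa [hy]
  have hAi : ∀ y : Fin d → ℝ, (fun x => τ (y, x)) ⁻¹' A = A := by
    intro w
    ext x
    simp only [Set.mem_preimage, hA, Set.mem_ofPred_eq, ← hτadd]
    have e := (measurePreserving_add_right (volume : Measure (Fin d → ℝ)) w).map_eq
    have hm : MeasurableSet {z | g (τ (z, x)) ∈ s} :=
      (hg.comp (hτm.comp measurable_prodMk_right)) hs
    have := ae_map_iff (μ := (volume : Measure (Fin d → ℝ))) (measurable_add_const w).aemeasurable hm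
    rw [e] at this
    exact this.symm
  rcases herg A hAm hAi with h | h
  · right
    filter_upwards [hAs, measure_eq_zero_iff_ae_notMem.1 h] with x h1 h2
    rwa [← h1]
  · left
    have h' : ∀ᵐ x ∂μ, x ∈ A := (mem_ae_iff_prob_eq_one hAm).2 h
    filter_upwards [hAs, h'] with x h1 h2
    rwa [← h1]

include hτm hτzero hτadd hmp herg in
lemma approx (U : Set X) (hU : MeasurableSet U) (δ : ENNReal) (hδ : 0 < δ) :
    ∃ φ : X → ℝ, Measurable φ ∧ (∃ C, ∀ x, |φ x| ≤ C) ∧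
      (∀ x, Tendsto (fun M : ℕ => ((M : ℝ) ^ d)⁻¹ * ∫ z in cubeQ d (M : ℝ), φ (τ (z, x)))
        atTop (nhds 0)) ∧
      ∫⁻ x, ‖U.indicator (fun _ => (1 : ℝ)) x - μ.real U - φ x‖ₑ ∂μ < δ := by
  set I : (B : Set X) → MeasurableSet B → Lp ℝ 2 μ := fun B hB =>
    indicatorConstLp 2 hB (measure_ne_top μ B) (1 : ℝ) with hI
  have hTm : ∀ w, Measurable fun x => τ (w, x) := fun w => (hmp w).measurable
  set S : Set (Lp ℝ 2 μ) := {φ | ∃ (B : Set X) (hB : MeasurableSet B) (w : Fin d → ℝ),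
    φ = I B hB - I ((fun x => τ (w, x)) ⁻¹' B) (hTm w hB)} with hS
  set f : Lp ℝ 2 μ := I U hU - μ.real U • I Set.univ MeasurableSet.univ with hf
  have hfS : f ∈ (Submodule.span ℝ S)ᗮᗮ := by
    rw [Submodule.mem_orthogonal']
    intro g hg
    rw [Submodule.mem_orthogonal] at hg
    have hgm : Measurable g := (Lp.stronglyMeasurable g).measurable
    have hgi : Integrable g μ := (Lp.memLp g).integrable (by norm_num)
    have hginv : ∀ w, ∀ᵐ x ∂μ, g (τ (w, x)) = g x := by
      intro w
      refine Integrable.ae_eq_of_forall_setIntegral_eq _ _ ((hmp w).integrable_comp_of_integrable hgi) hgi ?_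
      intro s hs _
      have hB : MeasurableSet ((fun x => τ (-w, x)) ⁻¹' s) := hTm (-w) hs
      have hpre : (fun x => τ (w, x)) ⁻¹' ((fun x => τ (-w, x)) ⁻¹' s) = s := by
        ext x
        simp [← hτadd, hτzero]
      have h1 := hg _ (Submodule.subset_span ⟨_, hB, w, rfl⟩)
      rw [inner_sub_left, hI] at h1
      simp only [L2.inner_indicatorConstLp_one, hpre] at h1
      rw [sub_eq_zero] at h1
      have h2 := setIntegral_map (μ := μ) (f := g) hB
        (by rw [(hmp w).map_eq]; exact hgi.aestronglyMeasurable) (hTm w).aemeasurable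
      rw [(hmp w).map_eq, hpre] at h2
      rw [← h1, h2]
    obtain ⟨c, hc⟩ := inv_const hτm hτadd herg g hgm hginv
    rw [hf, inner_sub_left, real_inner_smul_left, hI]
    simp only [L2.inner_indicatorConstLp_one]
    rw [setIntegral_congr_ae (g := fun _ => c) hU (by filter_upwards [hc] with x hx _ using hx),
      setIntegral_congr_ae (g := fun _ => c) MeasurableSet.univ (by filter_upwards [hc] with x hx _ using hx)]
    simp
  rw [Submodule.orthogonal_orthogonal_eq_closure] at hfS
  have hcl : f ∈ closure (Submodule.span ℝ S : Set (Lp ℝ 2 μ)) := hfS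
  rw [EMetric.mem_closure_iff] at hcl
  obtain ⟨ψ, hψ, hd⟩ := hcl δ hδ
  have hint : ∀ (φ : X → ℝ), Measurable φ → (∃ C, ∀ x, |φ x| ≤ C) → ∀ x (M : ℕ),
      IntegrableOn (fun z => φ (τ (z, x))) (cubeQ d (M : ℝ)) := by
    rintro φ hφ ⟨C, hC⟩ x M
    rw [cubeQ_eq _ _ (by positivity)]
    exact Measure.integrableOn_of_bounded (M := C) (isCompact_closedBall _ _).measure_lt_top.ne
      (hφ.comp (hτm.comp measurable_prodMk_right)).aestronglyMeasurable (ae_of_all _ fun z => hC _)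
  have hrep : ∃ φ : X → ℝ, Measurable φ ∧ (∃ C, ∀ x, |φ x| ≤ C) ∧
      (∀ x, Tendsto (fun M : ℕ => ((M : ℝ) ^ d)⁻¹ * ∫ z in cubeQ d (M : ℝ), φ (τ (z, x)))
        atTop (nhds 0)) ∧ ψ =ᵐ[μ] φ := by
    refine Submodule.span_induction (p := fun (ψ : Lp ℝ 2 μ) _ => ∃ φ : X → ℝ, Measurable φ ∧ (∃ C, ∀ x, |φ x| ≤ C) ∧
      (∀ x, Tendsto (fun M : ℕ => ((M : ℝ) ^ d)⁻¹ * ∫ z in cubeQ d (M : ℝ), φ (τ (z, x)))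
        atTop (nhds 0)) ∧ ψ =ᵐ[μ] φ) ?_ ?_ ?_ ?_ hψ
    · rintro _ ⟨B, hB, w, rfl⟩
      have hBm : Measurable (B.indicator fun _ => (1 : ℝ)) := measurable_const.indicator hB
      have hb0 : ∀ x, 0 ≤ B.indicator (fun _ => (1 : ℝ)) x := fun x =>
        Set.indicator_nonneg (fun _ _ => zero_le_one) x
      have hb1 : ∀ x, B.indicator (fun _ => (1 : ℝ)) x ≤ 1 := fun x =>
        Set.indicator_le_self' (fun _ _ => zero_le_one) x
      refine ⟨fun x => B.indicator (fun _ => (1 : ℝ)) x - B.indicator (fun _ => (1 : ℝ)) (τ (w, x)),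
        hBm.sub (hBm.comp (hTm w)), ⟨1, fun x => ?_⟩, fun x => ?_, ?_⟩
      · rw [abs_le]
        constructor <;> linarith [hb0 x, hb1 x, hb0 (τ (w, x)), hb1 (τ (w, x))]
      · have := cob_tendsto d (fun z => B.indicator (fun _ => (1 : ℝ)) (τ (z, x)))
          (hBm.comp (hτm.comp measurable_prodMk_right)) (fun z => hb0 _) (fun z => hb1 _) w
        refine this.congr fun M => ?_
        simp only [← hτadd, add_comm w]
      · filter_upwards [Lp.coeFn_sub (I B hB) (I _ (hTm w hB)),
          indicatorConstLp_coeFn (p := 2) (hs := hB) (hμs := measure_ne_top μ B) (c := (1 : ℝ)),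
          indicatorConstLp_coeFn (p := 2) (hs := hTm w hB) (hμs := measure_ne_top μ _) (c := (1 : ℝ))]
          with x h1 h2 h3
        rw [h1, Pi.sub_apply, h2, h3]
        rfl
    · exact ⟨0, measurable_zero, ⟨0, by simp⟩, by simp, Lp.coeFn_zero _ _ _⟩
    · rintro a b _ _ ⟨φ, h1, ⟨C, h2⟩, h3, h4⟩ ⟨φ', h1', ⟨C', h2'⟩, h3', h4'⟩
      refine ⟨φ + φ', h1.add h1', ⟨C + C', fun x => (abs_add_le _ _).trans (add_le_add (h2 x) (h2' x))⟩, fun x => ?_,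
        (Lp.coeFn_add a b).trans (h4.add h4')⟩
      have := (h3 x).add (h3' x)
      rw [add_zero] at this
      refine this.congr fun M => ?_
      simp only [Pi.add_apply]
      rw [integral_add (hint φ h1 ⟨C, h2⟩ x M) (hint φ' h1' ⟨C', h2'⟩ x M), mul_add]
    · rintro c a _ ⟨φ, h1, ⟨C, h2⟩, h3, h4⟩
      refine ⟨c • φ, h1.const_smul c, ⟨|c| * C, fun x => ?_⟩, fun x => ?_,
        (Lp.coeFn_smul c a).trans (h4.const_smul c)⟩
      · simp only [Pi.smul_apply, smul_eq_mul, abs_mul]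
        exact mul_le_mul_of_nonneg_left (h2 x) (abs_nonneg c)
      · have := (h3 x).const_mul c
        rw [mul_zero] at this
        refine this.congr fun M => ?_
        simp only [Pi.smul_apply, smul_eq_mul]
        rw [integral_const_mul]; ring
  obtain ⟨φ, h1, h2, h3, h4⟩ := hrep
  refine ⟨φ, h1, h2, h3, lt_of_le_of_lt ?_ hd⟩
  rw [Lp.edist_def, ← eLpNorm_one_eq_lintegral_enorm]
  refine (eLpNorm_le_eLpNorm_of_exponent_le (p := 1) (q := 2) (by norm_num)
    ?_).trans_eq (eLpNorm_congr_ae ?_)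
  · exact (((measurable_const.indicator hU).sub measurable_const).sub h1).aestronglyMeasurable
  · filter_upwards [h4, Lp.coeFn_sub (I U hU) (μ.real U • I Set.univ MeasurableSet.univ),
      Lp.coeFn_smul (μ.real U) (I Set.univ MeasurableSet.univ),
      indicatorConstLp_coeFn (p := 2) (hs := hU) (hμs := measure_ne_top μ U) (c := (1 : ℝ)),
      indicatorConstLp_coeFn (p := 2) (hs := MeasurableSet.univ) (hμs := measure_ne_top μ Set.univ) (c := (1 : ℝ))]
      with x k1 k2 k3 k4 k5
    rw [Pi.sub_apply, hf, k2, Pi.sub_apply, k3, Pi.smul_apply, k4, k5, k1]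
    simp
end
section
variable {X : Type*} [MeasurableSpace X] {d : ℕ}
    {τ : (Fin d → ℝ) × X → X} (hτm : Measurable τ)
    (hτzero : ∀ x, τ (0, x) = x)
    (hτadd : ∀ (y y' : Fin d → ℝ) (x : X), τ (y + y', x) = τ (y, τ (y', x)))
    {μ : Measure X} [IsProbabilityMeasure μ]
    (hmp : ∀ y : Fin d → ℝ, MeasurePreserving (fun x => τ (y, x)) μ μ)
    (herg : ∀ A : Set X, MeasurableSet A →
      (∀ y : Fin d → ℝ, (fun x => τ (y, x)) ⁻¹' A = A) → μ A = 0 ∨ μ A = 1)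

lemma vol_cube (d M : ℕ) : volume (cubeQ d (M : ℝ)) = (M : ENNReal) ^ d := by
  rw [cubeQ_eq _ _ (by positivity), vol_cb _ _ (by positivity),
    show 2 * ((M : ℝ) / 2) = M by ring]
  simp

include hτm hτzero hτadd hmp herg in
lemma ae_limsup (U : Set X) (hU : MeasurableSet U) (ε : ℝ) (hε : 0 < ε) :
    ∀ᵐ x ∂μ, ∀ᶠ M : ℕ in atTop,
      |((M : ℝ) ^ d)⁻¹ * (∫ y in cubeQ d (M : ℝ), U.indicator (fun _ => (1 : ℝ)) (τ (y, x)))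
        - μ.real U| ≤ 2 * ε := by
  rw [ae_iff]
  set Bad := {x | ¬ ∀ᶠ M : ℕ in atTop,
      |((M : ℝ) ^ d)⁻¹ * (∫ y in cubeQ d (M : ℝ), U.indicator (fun _ => (1 : ℝ)) (τ (y, x)))
        - μ.real U| ≤ 2 * ε} with hBad
  have hε' : ENNReal.ofReal ε ≠ 0 := by simpa using hε
  have key : ∀ δ : ENNReal, 0 < δ → ENNReal.ofReal ε * μ Bad ≤ 10 ^ d * δ := by
    intro δ hδ
    obtain ⟨φ, h1, ⟨C, hC⟩, h3, h4⟩ := approx hτm hτzero hτadd hmp herg U hU δ hδ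
    have hUm : Measurable (U.indicator fun _ => (1 : ℝ)) := measurable_const.indicator hU
    have hψm : Measurable fun x => U.indicator (fun _ => (1 : ℝ)) x - μ.real U - φ x :=
      (hUm.sub measurable_const).sub h1
    have hmax := maximal hτm hτadd hmp (fun x => ‖U.indicator (fun _ => (1 : ℝ)) x - μ.real U - φ x‖ₑ)
      hψm.enorm (ENNReal.ofReal ε)
    refine le_trans ?_ (hmax.trans (by gcongr))
    gcongr
    intro x hx
    by_contra hcon
    apply hx
    simp only [Set.mem_ofPred_eq, not_exists, not_and, not_le] at hcon
    have h5 := (h3 x).eventually (Metric.ball_mem_nhds 0 hε)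
    filter_upwards [h5, eventually_ge_atTop 1] with M hM hM1
    have hM1' : (1 : ℝ) ≤ M := by exact_mod_cast hM1
    have hp : (0 : ℝ) < (M : ℝ) ^ d := by positivity
    have hvt : volume (cubeQ d (M : ℝ)) ≠ ⊤ := by
      rw [vol_cube]; exact ENNReal.pow_ne_top (ENNReal.natCast_ne_top M)
    have hxm : Measurable fun z => τ (z, x) := hτm.comp measurable_prodMk_right
    have i1 : IntegrableOn (fun z => U.indicator (fun _ => (1 : ℝ)) (τ (z, x))) (cubeQ d (M : ℝ)) := by
      refine Measure.integrableOn_of_bounded (M := 1) hvt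
        (hUm.comp hxm).aestronglyMeasurable (ae_of_all _ fun z => ?_)
      by_cases h : τ (z, x) ∈ U <;> simp [h]
    have i2 : IntegrableOn (fun z => φ (τ (z, x))) (cubeQ d (M : ℝ)) :=
      Measure.integrableOn_of_bounded (M := C) hvt
        (h1.comp hxm).aestronglyMeasurable (ae_of_all _ fun z => hC _)
    have i3 : IntegrableOn (fun _ : Fin d → ℝ => μ.real U) (cubeQ d (M : ℝ)) := integrableOn_const hvt
    have e : ∫ z in cubeQ d (M : ℝ), (U.indicator (fun _ => (1 : ℝ)) (τ (z, x)) - μ.real U - φ (τ (z, x)))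
        = (∫ z in cubeQ d (M : ℝ), U.indicator (fun _ => (1 : ℝ)) (τ (z, x)))
          - (M : ℝ) ^ d * μ.real U - ∫ z in cubeQ d (M : ℝ), φ (τ (z, x)) := by
      have i4 : IntegrableOn (fun z => U.indicator (fun _ => (1 : ℝ)) (τ (z, x)) - μ.real U)
        (cubeQ d (M : ℝ)) := i1.sub i3
      rw [integral_sub i4 i2, integral_sub i1 i3]
      simp [measureReal_def, vol_cube]
    have hb : ‖∫ z in cubeQ d (M : ℝ), (U.indicator (fun _ => (1 : ℝ)) (τ (z, x)) - μ.real U - φ (τ (z, x)))‖ₑ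
        ≤ ENNReal.ofReal (ε * (M : ℝ) ^ d) := by
      refine (enorm_integral_le_lintegral_enorm _).trans ((hcon M hM1).le.trans_eq ?_)
      rw [ENNReal.ofReal_mul hε.le, ENNReal.ofReal_pow (by positivity), ENNReal.ofReal_natCast]
    rw [← ofReal_norm, ENNReal.ofReal_le_ofReal_iff (by positivity), e, Real.norm_eq_abs] at hb
    rw [dist_zero_right, Real.norm_eq_abs] at hM
    set a := ∫ z in cubeQ d (M : ℝ), U.indicator (fun _ => (1 : ℝ)) (τ (z, x))
    set b := ∫ z in cubeQ d (M : ℝ), φ (τ (z, x))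
    have : ((M : ℝ) ^ d)⁻¹ * a - μ.real U =
        ((M : ℝ) ^ d)⁻¹ * (a - (M : ℝ) ^ d * μ.real U - b) + ((M : ℝ) ^ d)⁻¹ * b := by
      field_simp; ring
    rw [this]
    have h6 : |((M : ℝ) ^ d)⁻¹ * (a - (M : ℝ) ^ d * μ.real U - b)| ≤ ε := by
      rw [abs_mul, abs_of_pos (inv_pos.2 hp), inv_mul_le_iff₀ hp, mul_comm _ ε]
      exact hb
    exact (abs_add_le _ _).trans (by linarith)
  by_contra hne
  have hpos : ENNReal.ofReal ε * μ Bad ≠ 0 := mul_ne_zero hε' hne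
  have hfin : ENNReal.ofReal ε * μ Bad ≠ ⊤ := ENNReal.mul_ne_top ENNReal.ofReal_ne_top (measure_ne_top _ _)
  have h10 : (10 : ENNReal) ^ d ≠ 0 := pow_ne_zero _ (by norm_num)
  have h10' : (10 : ENNReal) ^ d ≠ ⊤ := ENNReal.pow_ne_top (by norm_num)
  have := key (ENNReal.ofReal ε * μ Bad / 2 / 10 ^ d) (by
    refine ENNReal.div_pos ?_ h10'
    exact (ENNReal.half_pos hpos).ne')
  rw [ENNReal.mul_div_cancel h10 h10'] at this
  exact absurd (ENNReal.half_lt_self hpos hfin) (not_lt.2 this)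

include hτm hτzero hτadd hmp herg in
lemma ae_tendsto (U : Set X) (hU : MeasurableSet U) :
    ∀ᵐ x ∂μ, Tendsto (fun M : ℕ => 
      ((M : ℝ) ^ d)⁻¹ * (∫ y in cubeQ d (M : ℝ), U.indicator (fun _ => (1 : ℝ)) (τ (y, x))))
      atTop (nhds (μ.real U)) := by
  have h : ∀ n : ℕ, _ := fun n => ae_limsup hτm hτzero hτadd hmp herg U hU (1 / ((n : ℝ) + 1)) (by positivity)
  rw [← ae_all_iff] at h
  filter_upwards [h] with x hx
  rw [Metric.tendsto_nhds]
  intro ε hε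
  obtain ⟨n, hn⟩ := exists_nat_one_div_lt (show 0 < ε / 2 by positivity)
  filter_upwards [hx n] with M hM
  rw [Real.dist_eq]
  linarith
end

theorem stmt_11 {X : Type*} [TopologicalSpace X] [PolishSpace X]
    [MeasurableSpace X] [BorelSpace X] (d : ℕ) (hd : 1 ≤ d)
    (τ : (Fin d → ℝ) × X → X) (hτcont : Continuous τ)
    (hτzero : ∀ x, τ (0, x) = x)
    (hτadd : ∀ (y y' : Fin d → ℝ) (x : X), τ (y + y', x) = τ (y, τ (y', x)))
    (μ : Measure X) [IsProbabilityMeasure μ]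
    (hinv : ∀ y : Fin d → ℝ, Measure.map (fun x => τ (y, x)) μ = μ)
    (herg : ∀ A : Set X, MeasurableSet A →
      (∀ y : Fin d → ℝ, (fun x => τ (y, x)) ⁻¹' A = A) → μ A = 0 ∨ μ A = 1) :
    ∃ xb : X, ∀ F : BoundedContinuousFunction X ℝ,
      Tendsto (fun M : ℕ =>
          ((M : ℝ) ^ d)⁻¹ * ∫ y in cubeQ d (M : ℝ), F (τ (y, xb)))
        atTop (nhds (∫ x, F x ∂μ)) := by
  have hτm : Measurable τ := hτcont.measurable
  have hmp : ∀ y : Fin d → ℝ, MeasurePreserving (fun x => τ (y, x)) μ μ := fun y =>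
    ⟨hτm.comp measurable_prodMk_left, hinv y⟩
  set b := TopologicalSpace.countableBasis X with hb
  set S : Set (Set X) := Set.image (fun t : Set (Set X) => ⋂₀ t) {t | t.Finite ∧ t ⊆ b} with hS
  have hSc : S.Countable :=
    (Set.countable_ofPred_finite_subset (TopologicalSpace.countable_countableBasis X)).image _
  have hSo : ∀ s ∈ S, IsOpen s := by
    rintro _ ⟨t, ⟨ht, htb⟩, rfl⟩
    exact ht.isOpen_sInter fun u hu => TopologicalSpace.isOpen_of_mem_countableBasis (htb hu)
  have hSm : ∀ s ∈ S, MeasurableSet s := fun s hs => (hSo s hs).measurableSet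
  have hSpi : IsPiSystem S := by
    rintro _ ⟨t, ⟨ht, htb⟩, rfl⟩ _ ⟨t', ⟨ht', htb'⟩, rfl⟩ _
    exact ⟨t ∪ t', ⟨ht.union ht', Set.union_subset htb htb'⟩, Set.sInter_union _ _⟩
  have hae : ∀ᵐ x ∂μ, ∀ s ∈ S, Tendsto (fun M : ℕ => 
      ((M : ℝ) ^ d)⁻¹ * (∫ y in cubeQ d (M : ℝ), s.indicator (fun _ => (1 : ℝ)) (τ (y, x))))
      atTop (nhds (μ.real s)) := by
    rw [ae_ball_iff hSc]
    exact fun s hs => ae_tendsto hτm hτzero hτadd hmp herg s (hSm s hs)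
  obtain ⟨x, hx⟩ := hae.exists
  refine ⟨x, ?_⟩
  have hxm : Measurable fun z => τ (z, x) := hτm.comp measurable_prodMk_right
  set m : ℕ → Measure X := fun M => (((M + 1 : ℕ) : ENNReal) ^ d)⁻¹ •
    Measure.map (fun z => τ (z, x)) (volume.restrict (cubeQ d ((M + 1 : ℕ) : ℝ))) with hm
  have hmP : ∀ M, IsProbabilityMeasure (m M) := by
    intro M
    constructor
    simp only [hm, Measure.smul_apply, smul_eq_mul]
    rw [Measure.map_apply hxm MeasurableSet.univ, Set.preimage_univ, Measure.restrict_apply_univ, vol_cube]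
    exact ENNReal.inv_mul_cancel (pow_ne_zero _ (by exact_mod_cast Nat.succ_ne_zero M))
      (ENNReal.pow_ne_top (ENNReal.natCast_ne_top _))
  have hmi : ∀ M (f : X → ℝ), Measurable f → ∫ z, f z ∂(m M) =
      (((M + 1 : ℕ) : ℝ) ^ d)⁻¹ * ∫ y in cubeQ d ((M + 1 : ℕ) : ℝ), f (τ (y, x)) := by
    intro M f hf
    simp only [hm]
    rw [integral_smul_measure, integral_map hxm.aemeasurable hf.aestronglyMeasurable, smul_eq_mul,
      ENNReal.toReal_inv, ENNReal.toReal_pow, ENNReal.toReal_natCast]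
  let mP : ℕ → ProbabilityMeasure X := fun M => ⟨m M, hmP M⟩
  let μP : ProbabilityMeasure X := ⟨μ, inferInstance⟩
  have hT : Tendsto mP atTop (nhds μP) := by
    refine hSpi.tendsto_probabilityMeasure_of_tendsto_of_mem hSm ?_ ?_
    · intro u hu y hy
      obtain ⟨v, hv, hyv, hvu⟩ := (TopologicalSpace.isBasis_countableBasis X).exists_subset_of_mem_open hy hu
      refine ⟨v, ⟨{v}, ⟨Set.finite_singleton v, by simpa using hv⟩, by simp⟩,
        (TopologicalSpace.isOpen_of_mem_countableBasis hv).mem_nhds hyv, hvu⟩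
    · intro s hs
      rw [← NNReal.tendsto_coe]
      have := (tendsto_add_atTop_iff_nat 1).2 (hx s hs)
      refine this.congr fun M => ?_
      rw [← hmi M _ (measurable_const.indicator (hSm s hs)), integral_indicator (hSm s hs)]
      simp [measureReal_def]
      rfl
  rw [ProbabilityMeasure.tendsto_iff_forall_integral_tendsto] at hT
  intro F
  rw [← tendsto_add_atTop_iff_nat 1]
  exact (hT F).congr fun M => hmi M _ F.continuous.measurable
end

section
/- Let X be a metric space, τ : ℝ^d × X → X a jointly continuous action of (ℝ^d, +), F : X → ℝ a bounded uniformly continuous function, x̄ ∈ X, and I ∈ ℝ, and suppose that M^{−d}∫_{Q_M} F(τ(y, x̄)) dy → I as the integer M → ∞. Let (x_n) be a sequence in X and (M'_n), (M_n) positive reals with M'_n < M_n for all n, M_n → ∞, M'_n/M_n → 1, and sup_{y ∈ Q_{M'_n}} dist(τ(y, x_n), τ(y, x̄)) → 0 as n → ∞. Then M_n^{−d}∫_{Q_{M_n}} F(τ(y, x_n)) dy → I as n → ∞. -/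
open MeasureTheory Filter

lemma cubeQ_compact (d : ℕ) (M : ℝ) : IsCompact (cubeQ d M) :=
  isCompact_univ_pi fun _ => isCompact_Icc

lemma cubeQ_meas (d : ℕ) (M : ℝ) : MeasurableSet (cubeQ d M) :=
  (cubeQ_compact d M).isClosed.measurableSet

lemma cubeQ_vol (d : ℕ) {M : ℝ} (hM : 0 ≤ M) : (volume : Measure (Fin d → ℝ)).real (cubeQ d M) = M ^ d := by
  unfold cubeQ
  rw [measureReal_def, volume_pi_pi]
  simp only [Real.volume_Icc, Finset.prod_const, Finset.card_univ, Fintype.card_fin]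
  rw [ENNReal.toReal_pow, ENNReal.toReal_ofReal (by linarith)]
  congr 1
  ring

lemma cubeQ_mono (d : ℕ) {a b : ℝ} (hab : a ≤ b) : cubeQ d a ⊆ cubeQ d b :=
  Set.pi_mono fun _ _ => Set.Icc_subset_Icc (by linarith) (by linarith)

lemma cubeQ_diff (d : ℕ) {g : (Fin d → ℝ) → ℝ} (hg : Continuous g) {C : ℝ}
    (hC : ∀ y, |g y| ≤ C) {a b : ℝ} (ha : 0 ≤ a) (hab : a ≤ b) :
    |(∫ y in cubeQ d b, g y) - ∫ y in cubeQ d a, g y| ≤ C * (b ^ d - a ^ d) := by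
  have hint : IntegrableOn g (cubeQ d b) := hg.continuousOn.integrableOn_compact (cubeQ_compact d b)
  rw [← integral_diff (cubeQ_meas d a) hint (cubeQ_mono d hab)]
  have hfin : volume (cubeQ d b) < ⊤ := (cubeQ_compact d b).measure_lt_top
  have h := norm_setIntegral_le_of_norm_le_const (μ := volume) (s := cubeQ d b \ cubeQ d a) (f := g)
    (C := C) ((measure_mono Set.diff_subset).trans_lt hfin) (fun y _ => hC y)
  rw [measureReal_diff (cubeQ_mono d hab) (cubeQ_meas d a) hfin.ne, cubeQ_vol d ha,
    cubeQ_vol d (ha.trans hab)] at h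
  exact h

lemma cubeQ_close (d : ℕ) {g h : (Fin d → ℝ) → ℝ} (hg : Continuous g) (hh : Continuous h) {ε : ℝ}
    {a : ℝ} (ha : 0 ≤ a) (hC : ∀ y ∈ cubeQ d a, |g y - h y| ≤ ε) :
    |(∫ y in cubeQ d a, g y) - ∫ y in cubeQ d a, h y| ≤ ε * a ^ d := by
  rw [← integral_sub (hg.continuousOn.integrableOn_compact (cubeQ_compact d a))
    (hh.continuousOn.integrableOn_compact (cubeQ_compact d a))]
  have h := norm_setIntegral_le_of_norm_le_const (μ := volume) (s := cubeQ d a)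
    (f := fun y => g y - h y) (C := ε) (cubeQ_compact d a).measure_lt_top hC
  rw [cubeQ_vol d ha] at h
  exact h

/-- Let `τ` be a jointly continuous `ℝ^d`-action on a metric space
`X`, `F` bounded and uniformly continuous, `x̄ ∈ X`, `I ∈ ℝ` with
`M^{−d}∫_{Q_M} F(τ(y, x̄)) dy → I` along integers `M → ∞`. If `(x_n)`, `M'_n < M_n`,
`M_n → ∞`, `M'_n/M_n → 1` and `sup_{y ∈ Q_{M'_n}} dist(τ(y, x_n), τ(y, x̄)) → 0`,
then `M_n^{−d}∫_{Q_{M_n}} F(τ(y, x_n)) dy → I`. -/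
theorem stmt_12 {X : Type*} [MetricSpace X] (d : ℕ) (hd : 1 ≤ d)
    (τ : (Fin d → ℝ) × X → X) (hτcont : Continuous τ)
    (hτzero : ∀ x, τ (0, x) = x)
    (hτadd : ∀ (y y' : Fin d → ℝ) (x : X), τ (y + y', x) = τ (y, τ (y', x)))
    (F : X → ℝ) (hFuc : UniformContinuous F) (hFb : ∃ M : ℝ, ∀ x, |F x| ≤ M)
    (xb : X) (I : ℝ)
    (hI : Tendsto (fun M : ℕ =>
        ((M : ℝ) ^ d)⁻¹ * ∫ y in cubeQ d (M : ℝ), F (τ (y, xb))) atTop (nhds I))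
    (x : ℕ → X) (M' M : ℕ → ℝ)
    (hM'pos : ∀ n, 0 < M' n) (hlt : ∀ n, M' n < M n)
    (hMtop : Tendsto M atTop atTop)
    (hratio : Tendsto (fun n => M' n / M n) atTop (nhds 1))
    (hsup : ∀ ε : ℝ, 0 < ε → ∃ N : ℕ, ∀ n ≥ N, ∀ y ∈ cubeQ d (M' n),
      dist (τ (y, x n)) (τ (y, xb)) < ε) :
    Tendsto (fun n : ℕ =>
        ((M n) ^ d)⁻¹ * ∫ y in cubeQ d (M n), F (τ (y, x n))) atTop (nhds I) := by
  obtain ⟨C, hC⟩ := hFb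
  have hcont : ∀ z, Continuous fun y => F (τ (y, z)) := fun z =>
    hFuc.continuous.comp (hτcont.comp (by fun_prop))
  have hMpos : ∀ n, 0 < M n := fun n => (hM'pos n).trans (hlt n)
  have hfl : Tendsto (fun n => (⌊M n⌋₊ : ℝ) / M n) atTop (nhds 1) :=
    (tendsto_nat_floor_div_atTop (R := ℝ)).comp hMtop
  have hI' := hI.comp ((tendsto_nat_floor_atTop (α := ℝ)).comp hMtop)
  have hmain := (hfl.pow d).mul hI'
  rw [one_pow, one_mul] at hmain
  have hE1 : Tendsto (fun n => 2 * C * (1 - (M' n / M n) ^ d) + C * (1 - ((⌊M n⌋₊ : ℝ) / M n) ^ d))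
      atTop (nhds 0) := by
    have := (((hratio.pow d).const_sub 1).const_mul (2 * C)).add
      (((hfl.pow d).const_sub 1).const_mul C)
    simpa using this
  refine tendsto_of_tendsto_of_dist hmain ?_
  rw [Metric.tendsto_atTop]
  intro ε hε
  obtain ⟨δ, hδ, hFδ⟩ := Metric.uniformContinuous_iff.1 hFuc (ε / 2) (half_pos hε)
  obtain ⟨N, hN⟩ := hsup δ hδ
  have hev := hE1.eventually (gt_mem_nhds (half_pos hε))
  have hev2 := (hMtop.eventually_ge_atTop 1)
  obtain ⟨N2, hN2⟩ := eventually_atTop.1 (hev.and hev2)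
  refine ⟨max N N2, fun n hn => ?_⟩
  obtain ⟨h1, hM1⟩ := hN2 n (le_of_max_le_right hn)
  have hm := hMpos n
  have hk0 : (0 : ℝ) < ⌊M n⌋₊ := by exact_mod_cast Nat.floor_pos.2 hM1
  have b1 := cubeQ_diff d (hcont (x n)) (fun y => hC _) (hM'pos n).le (hlt n).le
  have b2 := cubeQ_close d (hcont (x n)) (hcont xb) (ε := ε / 2) (hM'pos n).le
    (fun y hy => (hFδ (hN n (le_of_max_le_left hn) y hy)).le)
  have b3 := cubeQ_diff d (hcont xb) (fun y => hC _) (hM'pos n).le (hlt n).le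
  have b4 := cubeQ_diff d (hcont xb) (fun y => hC _) hk0.le (Nat.floor_le hm.le)
  have hMd : 0 < M n ^ d := by positivity
  have hle : M' n ^ d ≤ M n ^ d := pow_le_pow_left₀ (hM'pos n).le (hlt n).le d
  have hle2 : ε / 2 * M' n ^ d ≤ ε / 2 * M n ^ d := mul_le_mul_of_nonneg_left hle (half_pos hε).le
  rw [Real.dist_0_eq_abs, abs_of_nonneg dist_nonneg, dist_comm, Real.dist_eq]
  simp only [Function.comp_apply]
  set A := ∫ y in cubeQ d (M n), F (τ (y, x n))
  set B := ∫ y in cubeQ d (⌊M n⌋₊ : ℝ), F (τ (y, xb))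
  have heq : (M n ^ d)⁻¹ * A - ((⌊M n⌋₊ : ℝ) / M n) ^ d * (((⌊M n⌋₊ : ℝ) ^ d)⁻¹ * B)
      = (A - B) / M n ^ d := by
    rw [div_pow]
    field_simp
  rw [heq, abs_div, abs_of_pos hMd, div_lt_iff₀ hMd]
  have h2 := mul_lt_mul_of_pos_right h1 hMd
  have h3 : (2 * C * (1 - (M' n / M n) ^ d) + C * (1 - ((⌊M n⌋₊ : ℝ) / M n) ^ d)) * M n ^ d
      = 2 * C * (M n ^ d - M' n ^ d) + C * (M n ^ d - (⌊M n⌋₊ : ℝ) ^ d) := by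
    rw [div_pow, div_pow]
    field_simp
  rw [h3] at h2
  rw [abs_le] at b1 b2 b3 b4
  rw [abs_lt]
  constructor <;> linarith [b1.1, b1.2, b2.1, b2.2, b3.1, b3.2, b4.1, b4.2]
end
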